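/- For every n ∈ ℤ_{≥1}, the subgroup 𝓑·K_n of K (the set of products b·g with b ∈ 𝓑 and g ∈ K_n, which is a subgroup since K_n is normal in K) has index (q+1)·q^{n−1} in K. -/

import Mathlib

open Matrix

noncomputable section

/-- A 2×2 matrix over `E`. -/
abbrev Mat (E : Type) := Matrix (Fin 2) (Fin 2) E

/-- The context: `E/F` is the unramified quadratic extension of a finite extension `F` of
`ℚ_p` (`p` odd), encoded via the Galois involution `sig` (whose fixed field is `F`),
the valuation `nu` (normalized by `nu ϖ = 1` for a uniformizer `ϖ` of `F`),
a square root `sqeps` of a non-square unit `eps = sqeps^2` of `O_F`, the residue-field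
cardinality `q` of `F`, and an additive character `psi'` of `F` trivial on `p_F` and
nontrivial on `O_F`. -/
structure USetting (E : Type) [Field E] where
  sig : E →+* E
  nu : E → WithTop ℤ
  sqeps : E
  pi : E
  q : ℕ
  psi' : E → ℂ
  sig_invol : ∀ x, sig (sig x) = x
  sig_ne : ∃ x, sig x ≠ x
  nu_eq_top : ∀ x, nu x = ⊤ ↔ x = 0
  nu_mul : ∀ x y, nu (x * y) = nu x + nu y
  nu_add : ∀ x y, min (nu x) (nu y) ≤ nu (x + y)
  nu_sig : ∀ x, nu (sig x) = nu x
  nu_pi : nu pi = 1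
  sig_pi : sig pi = pi
  sig_sqeps : sig sqeps = - sqeps
  nu_sqeps : nu sqeps = 0
  eps_not_square : ∀ y, sig y = y → y * y ≠ sqeps * sqeps
  gen : ∀ x : E, ∃ a b, sig a = a ∧ sig b = b ∧ x = a + b * sqeps
  nu_two : nu 2 = 0
  charzero : ∀ n : ℕ, (n : E) = 0 → n = 0
  complete : ∀ f : ℕ → E, (∀ n : ℕ, ((n : ℤ) : WithTop ℤ) ≤ nu (f (n + 1) - f n)) →
    ∃ L, ∀ n : ℕ, ((n : ℤ) : WithTop ℤ) ≤ nu (L - f n)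
  res_card : ∃ R : Finset E, R.card = q ∧ (∀ x ∈ R, sig x = x ∧ 0 ≤ nu x) ∧
    ∀ y : E, sig y = y → 0 ≤ nu y → ∃! x, x ∈ R ∧ 1 ≤ nu (y - x)
  psi'_mul : ∀ x y, sig x = x → sig y = y → psi' (x + y) = psi' x * psi' y
  psi'_ne : ∀ x, sig x = x → psi' x ≠ 0
  psi'_triv : ∀ x, sig x = x → 1 ≤ nu x → psi' x = 1
  psi'_nontriv : ∃ x, sig x = x ∧ 0 ≤ nu x ∧ psi' x ≠ 1

variable {E : Type} [Field E]

/-- The matrix `w₀ = [[0,1],[1,0]]`. -/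
def w0 (E : Type) [Field E] : Mat E := !![0, 1; 1, 0]

/-- `G = U(1,1)(F)`. -/
def Gset (S : USetting E) : Set (Mat E) :=
  {g | (g.map ⇑S.sig)ᵀ * w0 E * g = w0 E}

/-- `K = G ∩ GL₂(O_E)`: entries in `O_E` and determinant in `O_E^×`. -/
def Kset (S : USetting E) : Set (Mat E) :=
  {g | g ∈ Gset S ∧ (∀ i j, 0 ≤ S.nu (g i j)) ∧ S.nu g.det = 0}

/-- The congruence filtration subgroup `K_n` (for `n ≥ 1`; `K_0 = K` as a set). -/
def Kfil (S : USetting E) (n : ℤ) : Set (Mat E) :=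
  {g | g ∈ Kset S ∧ ∀ i j, (n : WithTop ℤ) ≤ S.nu ((g - 1) i j)}

/-- `𝓑 = B ∩ K`, the upper triangular matrices in `K`. -/
def Bcal (S : USetting E) : Set (Mat E) := {g | g ∈ Kset S ∧ g 1 0 = 0}

/-- `E^1`, the norm-one elements of `E`. -/
def E1set (S : USetting E) : Set E := {x | x * S.sig x = 1}

/-- `O_F^×` as a subset of `E`. -/
def OFunits (S : USetting E) : Set E := {x | S.sig x = x ∧ S.nu x = 0}

/-- `O_E^×` as a subset of `E`. -/
def OEunits (S : USetting E) : Set E := {x | S.nu x = 0}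

/-- A character of `E^×`, encoded as a function `E → ℂ` multiplicative and
nonvanishing on nonzero elements. -/
def IsChar (χ : E → ℂ) : Prop :=
  (∀ x y : E, x ≠ 0 → y ≠ 0 → χ (x * y) = χ x * χ y) ∧ ∀ x : E, x ≠ 0 → χ x ≠ 0

/-- A group homomorphism `E^1 → ℂ^×`, encoded as a function `E → ℂ`. -/
def IsE1Hom (S : USetting E) (φ : E → ℂ) : Prop :=
  (∀ x ∈ E1set S, ∀ y ∈ E1set S, φ (x * y) = φ x * φ y) ∧ ∀ x ∈ E1set S, φ x ≠ 0

/-- A homomorphism into `ℂ^×` on a subset of matrices. -/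
def IsHomOn (A : Set (Mat E)) (Ψ : Mat E → ℂ) : Prop :=
  (∀ x ∈ A, ∀ y ∈ A, Ψ (x * y) = Ψ x * Ψ y) ∧ ∀ x ∈ A, Ψ x ≠ 0

/-- `1 + p_E^n`. -/
def onePE (S : USetting E) (n : ℤ) : Set E := {x | (n : WithTop ℤ) ≤ S.nu (x - 1)}

/-- `1 + p_F^n`. -/
def onePF (S : USetting E) (n : ℤ) : Set E :=
  {x | S.sig x = x ∧ (n : WithTop ℤ) ≤ S.nu (x - 1)}

/-- `χ` is trivial on a set. -/
def TrivOn (χ : E → ℂ) (s : Set E) : Prop := ∀ x ∈ s, χ x = 1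

/-- `χ` has depth `r`: trivial on `1+p_E^{r+1}` and (if `r ≥ 1`) nontrivial on `1+p_E^r`. -/
def HasDepth (S : USetting E) (χ : E → ℂ) (r : ℕ) : Prop :=
  TrivOn χ (onePE S ((r : ℤ) + 1)) ∧ (r = 0 ∨ ¬ TrivOn χ (onePE S (r : ℤ)))

/-- `χ` has true depth `r`: the depth of its restriction to `F^×` is `r`. -/
def HasTrueDepth (S : USetting E) (χ : E → ℂ) (r : ℕ) : Prop :=
  TrivOn χ (onePF S ((r : ℤ) + 1)) ∧ (r = 0 ∨ ¬ TrivOn χ (onePF S (r : ℤ)))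

/-- `χ` has minimal depth `r`: its depth and true depth both equal `r`. -/
def MinDepth (S : USetting E) (χ : E → ℂ) (r : ℕ) : Prop :=
  HasDepth S χ r ∧ HasTrueDepth S χ r

/-- Right translation action on functions. -/
def rho (g : Mat E) : (Mat E → ℂ) →ₗ[ℂ] (Mat E → ℂ) where
  toFun f := fun k => f (k * g)
  map_add' _ _ := rfl
  map_smul' _ _ := rfl

/-- The space `V_χ^{K_n}`: functions on `K` (extended by zero off `K`) satisfying
`f(bk) = χ(b₁₁) f(k)` for `b ∈ 𝓑` and right `K_n`-invariance. -/
def Vsp (S : USetting E) (χ : E → ℂ) (n : ℤ) : Submodule ℂ (Mat E → ℂ) where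
  carrier := {f | (∀ x, x ∉ Kset S → f x = 0) ∧
    (∀ b ∈ Bcal S, ∀ k ∈ Kset S, f (b * k) = χ (b 0 0) * f k) ∧
    (∀ k ∈ Kset S, ∀ g ∈ Kfil S n, f (k * g) = f k)}
  add_mem' := by
    rintro f g ⟨hf0, hf1, hf2⟩ ⟨hg0, hg1, hg2⟩
    refine ⟨fun x hx => ?_, fun b hb k hk => ?_, fun k hk g' hg' => ?_⟩
    · simp [hf0 x hx, hg0 x hx]
    · simp only [Pi.add_apply, hf1 b hb k hk, hg1 b hb k hk]; ring
    · simp only [Pi.add_apply, hf2 k hk g' hg', hg2 k hk g' hg']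
  zero_mem' := by
    refine ⟨fun x _ => rfl, fun b _ k _ => by simp, fun k _ g _ => rfl⟩
  smul_mem' := by
    rintro c f ⟨hf0, hf1, hf2⟩
    refine ⟨fun x hx => ?_, fun b hb k hk => ?_, fun k hk g' hg' => ?_⟩
    · simp [hf0 x hx]
    · simp only [Pi.smul_apply, hf1 b hb k hk, smul_eq_mul]; ring
    · simp only [Pi.smul_apply, hf2 k hk g' hg']

/-- The space of the representation induced from a character `Ψ` of a subgroup `H ⊆ K`:
functions on `K` (extended by zero) with `f(hk) = Ψ(h) f(k)`. -/
def IndSp (S : USetting E) (H : Set (Mat E)) (Ψ : Mat E → ℂ) : Submodule ℂ (Mat E → ℂ) where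
  carrier := {f | (∀ x, x ∉ Kset S → f x = 0) ∧
    ∀ h ∈ H, ∀ k ∈ Kset S, f (h * k) = Ψ h * f k}
  add_mem' := by
    rintro f g ⟨hf0, hf1⟩ ⟨hg0, hg1⟩
    refine ⟨fun x hx => ?_, fun h hh k hk => ?_⟩
    · simp [hf0 x hx, hg0 x hx]
    · simp only [Pi.add_apply, hf1 h hh k hk, hg1 h hh k hk]; ring
  zero_mem' := ⟨fun x _ => rfl, fun h _ k _ => by simp⟩
  smul_mem' := by
    rintro c f ⟨hf0, hf1⟩
    refine ⟨fun x hx => ?_, fun h hh k hk => ?_⟩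
    · simp [hf0 x hx]
    · simp only [Pi.smul_apply, hf1 h hh k hk, smul_eq_mul]; ring

/-- The functions constant on `K` and zero off `K`. -/
def ConstSub (S : USetting E) : Submodule ℂ (Mat E → ℂ) where
  carrier := {f | (∀ x, x ∉ Kset S → f x = 0) ∧ ∃ c : ℂ, ∀ k ∈ Kset S, f k = c}
  add_mem' := by
    rintro f g ⟨hf0, c, hc⟩ ⟨hg0, c', hc'⟩
    exact ⟨fun x hx => by simp [hf0 x hx, hg0 x hx],
      c + c', fun k hk => by simp [hc k hk, hc' k hk]⟩
  zero_mem' := ⟨fun x _ => rfl, 0, fun _ _ => rfl⟩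
  smul_mem' := by
    rintro a f ⟨hf0, c, hc⟩
    exact ⟨fun x hx => by simp [hf0 x hx], a * c, fun k hk => by simp [hc k hk]⟩

/-- A subspace is `K`-invariant. -/
def KInvariant (S : USetting E) (W : Submodule ℂ (Mat E → ℂ)) : Prop :=
  ∀ g ∈ Kset S, ∀ f ∈ W, rho g f ∈ W

/-- A subset `A ⊆ K` acts trivially on `W`. -/
def ActsTrivially (S : USetting E) (A : Set (Mat E)) (W : Submodule ℂ (Mat E → ℂ)) : Prop :=
  ∀ g ∈ A, ∀ f ∈ W, rho g f = f

/-- `W` is an irreducible representation of `K`. -/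
def IsIrredRep (S : USetting E) (W : Submodule ℂ (Mat E → ℂ)) : Prop :=
  W ≠ ⊥ ∧ KInvariant S W ∧
    ∀ U : Submodule ℂ (Mat E → ℂ), U ≤ W → KInvariant S U → U = ⊥ ∨ U = W

/-- `V` and `W` are isomorphic as representations of `K`. -/
def RepIso (S : USetting E) (V W : Submodule ℂ (Mat E → ℂ)) : Prop :=
  ∃ e : (Mat E → ℂ) →ₗ[ℂ] (Mat E → ℂ), Set.BijOn ⇑e ↑V ↑W ∧
    ∀ g ∈ Kset S, ∀ f ∈ V, e (rho g f) = rho g (e f)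

/-- The space of `ℂ`-linear endomorphisms of `V` commuting with the right-translation
action of `K`, realized inside the function space `↥V → ↥V`. -/
def Commutant (S : USetting E) (V : Submodule ℂ (Mat E → ℂ)) :
    Submodule ℂ (↥V → ↥V) where
  carrier := {T | (∀ x y : ↥V, T (x + y) = T x + T y) ∧
    (∀ (c : ℂ) (x : ↥V), T (c • x) = c • T x) ∧
    ∀ g ∈ Kset S, ∀ f : ↥V, ∀ h : rho g (f : Mat E → ℂ) ∈ V,
      ((T ⟨rho g (f : Mat E → ℂ), h⟩ : ↥V) : Mat E → ℂ) = rho g ((T f : ↥V) : Mat E → ℂ)}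
  add_mem' := by
    rintro T T' ⟨hT1, hT2, hT3⟩ ⟨hT1', hT2', hT3'⟩
    refine ⟨fun x y => ?_, fun c x => ?_, fun g hg f h => ?_⟩
    · simp only [Pi.add_apply, hT1 x y, hT1' x y]; abel
    · simp only [Pi.add_apply, hT2 c x, hT2' c x, smul_add]
    · simp only [Pi.add_apply, Submodule.coe_add, hT3 g hg f h, hT3' g hg f h, map_add]
  zero_mem' := by
    refine ⟨fun x y => by simp, fun c x => by simp, fun g hg f h => by simp⟩
  smul_mem' := by
    rintro c T ⟨hT1, hT2, hT3⟩
    refine ⟨fun x y => ?_, fun a x => ?_, fun g hg f h => ?_⟩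
    · simp only [Pi.smul_apply, hT1 x y, smul_add]
    · simp only [Pi.smul_apply, hT2 a x, smul_comm c a]
    · simp only [Pi.smul_apply, Submodule.coe_smul, hT3 g hg f h, _root_.map_smul]

/-- The additive character `ψ` of `E`, `ψ(x) = ψ'((x + σ(x))/2)`. -/
def psiE (S : USetting E) (x : E) : ℂ := S.psi' ((x + S.sig x) / 2)

/-- `Ψ_Y(g) = ψ(Tr(Y (g − 1)))`. -/
def PsiC (S : USetting E) (Y g : Mat E) : ℂ := psiE S ((Y * (g - 1)).trace)

/-- The Lie algebra `𝔤 = 𝔲(1,1)(F)`. -/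
def gfrak (S : USetting E) : Set (Mat E) :=
  {Y | (Y.map ⇑S.sig)ᵀ * w0 E + w0 E * Y = 0}

/-- The lattice `𝔨_s` of the Lie algebra, where `c = ⌈s⌉`. -/
def kfrakC (S : USetting E) (c : ℤ) : Set (Mat E) :=
  {Y | Y ∈ gfrak S ∧ (c : WithTop ℤ) ≤ S.nu (Y 0 0) ∧ (c : WithTop ℤ) ≤ S.nu (Y 1 1) ∧
    (∃ t, S.sig t = t ∧ (c : WithTop ℤ) ≤ S.nu t ∧ Y 0 1 = S.sqeps * t) ∧
    (∃ t, S.sig t = t ∧ (c : WithTop ℤ) ≤ S.nu t ∧ Y 1 0 = S.sqeps * t)}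

/-- The group `J_d`. -/
def Jgrp (S : USetting E) (d : ℕ) : Set (Mat E) :=
  {g | g ∈ Kset S ∧ ((((d + 1) / 2 : ℕ) : WithTop ℤ) ≤ S.nu (g 0 0 - 1)) ∧
    ((((d + 1) / 2 : ℕ) : WithTop ℤ) ≤ S.nu (g 0 1)) ∧
    ((((d + 1) / 2 : ℕ) : WithTop ℤ) ≤ S.nu (g 1 1 - 1)) ∧
    (((d / 2 + 1 : ℕ) : WithTop ℤ) ≤ S.nu (g 1 0))}

/-- The centralizer `T(X)` in `K` of `X = [[z√ε, u√ε],[v√ε, z√ε]]`. -/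
def TXset (S : USetting E) (u v : E) : Set (Mat E) :=
  {m | m ∈ Kset S ∧ m 1 1 = m 0 0 ∧ m 1 0 = m 0 1 * (u⁻¹ * v)}

/-- The center `Z` of `G`, identified with scalar matrices with entries in `E^1`. -/
def Zset (S : USetting E) : Set (Mat E) := {m | ∃ z ∈ E1set S, m = z • (1 : Mat E)}

/-- `𝒰 = U ∩ K`. -/
def Uset (S : USetting E) : Set (Mat E) :=
  {m | ∃ b, S.sig b = b ∧ 0 ≤ S.nu b ∧ m = !![1, b * S.sqeps; 0, 1]}

/-- The set of products `T(X)·J_d`. -/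
def TXJ (S : USetting E) (u v : E) (d : ℕ) : Set (Mat E) :=
  {x | ∃ t ∈ TXset S u v, ∃ j ∈ Jgrp S d, x = t * j}

/-- The set of products `Z·𝒰·J_d`. -/
def ZUJ (S : USetting E) (d : ℕ) : Set (Mat E) :=
  {x | ∃ z ∈ Zset S, ∃ m ∈ Uset S, ∃ j ∈ Jgrp S d, x = z * m * j}

/-- `X = [[z√ε, u√ε],[v√ε, z√ε]]`. -/
def Xzuv (S : USetting E) (z u v : E) : Mat E :=
  !![z * S.sqeps, u * S.sqeps; v * S.sqeps, z * S.sqeps]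

/-- The nilpotent element `X_δ = [[0, δ√ε],[0,0]]`. -/
def Xdelta (S : USetting E) (δ : E) : Mat E := !![0, δ * S.sqeps; 0, 0]

/-- `W` is a `K`-invariant complement of `V_χ^{K_d}` inside `V_χ^{K_{d+1}}`. -/
def Wcompl (S : USetting E) (χ : E → ℂ) (d : ℕ) (W : Submodule ℂ (Mat E → ℂ)) : Prop :=
  W ≤ Vsp S χ ((d : ℤ) + 1) ∧ KInvariant S W ∧
    Vsp S χ (d : ℤ) ⊓ W = ⊥ ∧ Vsp S χ (d : ℤ) ⊔ W = Vsp S χ ((d : ℤ) + 1)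

/-- The valuation of a setting as an `AddValuation`. -/
def USetting.val (S : USetting E) : AddValuation E (WithTop ℤ) :=
  AddValuation.of S.nu ((S.nu_eq_top 0).2 rfl)
    (by
      have h := S.nu_mul 1 1
      have h1 : S.nu 1 ≠ ⊤ := fun h => one_ne_zero ((S.nu_eq_top 1).1 h)
      rw [mul_one] at h
      lift S.nu 1 to ℤ using h1 with a
      norm_cast at h ⊢
      omega)
    S.nu_add S.nu_mul

namespace USetting

variable (S : USetting E)

lemma nu_zero : S.nu 0 = ⊤ := (S.nu_eq_top 0).2 rfl

lemma nu_one : S.nu 1 = 0 := S.val.map_one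

lemma nu_neg (x : E) : S.nu (-x) = S.nu x := S.val.map_neg x

lemma le_nu_add {m : WithTop ℤ} {x y : E} (hx : m ≤ S.nu x) (hy : m ≤ S.nu y) :
    m ≤ S.nu (x + y) := (le_min hx hy).trans (S.nu_add x y)

lemma le_nu_sub {m : WithTop ℤ} {x y : E} (hx : m ≤ S.nu x) (hy : m ≤ S.nu y) :
    m ≤ S.nu (x - y) := by
  rw [sub_eq_add_neg]
  exact S.le_nu_add hx (by rwa [S.nu_neg])

lemma le_nu_mul {m : WithTop ℤ} {x y : E} (hx : 0 ≤ S.nu x) (hy : m ≤ S.nu y) :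
    m ≤ S.nu (x * y) := by
  rw [S.nu_mul]
  exact le_add_of_nonneg_of_le hx hy

lemma one_le_nu {x : E} (h0 : 0 ≤ S.nu x) (h : S.nu x ≠ 0) : 1 ≤ S.nu x := by
  have h1 : 0 < S.nu x := lt_of_le_of_ne h0 (Ne.symm h)
  cases hx : S.nu x with
  | top => exact le_top
  | coe a =>
    rw [hx] at h1
    norm_cast at h1 ⊢

lemma not_one_le_zero : ¬ (1 : WithTop ℤ) ≤ 0 := by
  norm_cast

lemma one_add_le_iff (m : ℤ) (x : WithTop ℤ) :
    ((m + 1 : ℤ) : WithTop ℤ) ≤ 1 + x ↔ (m : WithTop ℤ) ≤ x := by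
  cases x with
  | top => simp
  | coe a =>
    norm_cast
    omega

lemma ne_zero_of_nu_eq_zero {x : E} (h : S.nu x = 0) : x ≠ 0 := by
  rintro rfl
  rw [S.nu_zero] at h
  exact WithTop.top_ne_zero h

lemma nu_div_of_unit (x : E) {y : E} (h : S.nu y = 0) : S.nu (x / y) = S.nu x := by
  have := S.nu_mul (x / y) y
  rw [div_mul_cancel₀ x (S.ne_zero_of_nu_eq_zero h), h, add_zero] at this
  exact this.symm

lemma pi_ne_zero : S.pi ≠ 0 := by
  intro h
  have := S.nu_pi
  rw [h, S.nu_zero] at this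
  exact WithTop.top_ne_one this

lemma sqeps_ne_zero : S.sqeps ≠ 0 := S.ne_zero_of_nu_eq_zero S.nu_sqeps

/-- An element of the fixed ring of positive valuation is divisible by the uniformizer. -/
lemma exists_eq_pi_mul {x : E} (hx : S.sig x = x) (h : 1 ≤ S.nu x) :
    ∃ u, S.sig u = u ∧ 0 ≤ S.nu u ∧ x = S.pi * u := by
  have hxu : x = S.pi * (x / S.pi) := (mul_div_cancel₀ x S.pi_ne_zero).symm
  refine ⟨x / S.pi, by rw [map_div₀, hx, S.sig_pi], ?_, hxu⟩
  rw [hxu, S.nu_mul, S.nu_pi] at h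
  have := (one_add_le_iff 0 (S.nu (x / S.pi))).1 (by simpa using h)
  simpa using this

/-- The quotient of the ring of integers of the fixed field by the `n`-th power of its maximal
ideal has a system of representatives of cardinality `q ^ n`. -/
lemma exists_representatives (n : ℕ) :
    ∃ R : Finset E, R.card = S.q ^ n ∧ (∀ x ∈ R, S.sig x = x ∧ 0 ≤ S.nu x) ∧
      (∀ x ∈ R, ∀ y ∈ R, ((n : ℤ) : WithTop ℤ) ≤ S.nu (x - y) → x = y) ∧
      ∀ y : E, S.sig y = y → 0 ≤ S.nu y → ∃ x ∈ R, ((n : ℤ) : WithTop ℤ) ≤ S.nu (y - x) := by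
  classical
  induction n with
  | zero =>
    refine ⟨{0}, by simp, by simp [S.nu_zero], by simp, fun y _ hy => ⟨0, by simp, ?_⟩⟩
    simpa using hy
  | succ n ih =>
    obtain ⟨R, hRc, hR, hRi, hRs⟩ := ih
    obtain ⟨R₁, hc, h₁, hu⟩ := S.res_card
    have hinj : ∀ x ∈ R₁, ∀ y ∈ R, ∀ x' ∈ R₁, ∀ y' ∈ R,
        (((n + 1 : ℕ) : ℤ) : WithTop ℤ) ≤ S.nu ((x + S.pi * y) - (x' + S.pi * y')) →
          x = x' ∧ y = y' := by
      intro x hx y hy x' hx' y' hy' h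
      have hpos : (1 : WithTop ℤ) ≤ (((n + 1 : ℕ) : ℤ) : WithTop ℤ) := by
        norm_cast
        omega
      have hpi : ∀ z ∈ R, 1 ≤ S.nu (S.pi * z) := fun z hz => by
        rw [mul_comm]
        exact S.le_nu_mul (hR z hz).2 S.nu_pi.ge
      have hxx : x = x' := by
        refine (hu x (h₁ x hx).1 (h₁ x hx).2).unique ⟨hx, by simp [S.nu_zero]⟩ ⟨hx', ?_⟩
        have h2 := S.le_nu_sub (hpos.trans h) (S.le_nu_sub (hpi y hy) (hpi y' hy'))
        have e : x + S.pi * y - (x' + S.pi * y') - (S.pi * y - S.pi * y') = x - x' := by ring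
        rwa [e] at h2
      subst hxx
      refine ⟨rfl, hRi y hy y' hy' ?_⟩
      have e : x + S.pi * y - (x + S.pi * y') = S.pi * (y - y') := by ring
      rw [e, S.nu_mul, S.nu_pi] at h
      exact (one_add_le_iff n _).1 (by exact_mod_cast h)
    refine ⟨(R₁ ×ˢ R).image fun z => z.1 + S.pi * z.2, ?_, ?_, ?_, ?_⟩
    · rw [Finset.card_image_of_injOn, Finset.card_product, hc, hRc, pow_succ']
      rintro ⟨x, y⟩ hz ⟨x', y'⟩ hz' h
      simp only [Finset.coe_product, Set.mem_prod, Finset.mem_coe] at hz hz' h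
      obtain ⟨rfl, rfl⟩ := hinj x hz.1 y hz.2 x' hz'.1 y' hz'.2 (by simp [h, S.nu_zero])
      rfl
    · intro z hz
      obtain ⟨⟨x, y⟩, hxy, rfl⟩ := Finset.mem_image.1 hz
      obtain ⟨hx, hy⟩ := Finset.mem_product.1 hxy
      refine ⟨by simp [S.sig_pi, (h₁ _ hx).1, (hR _ hy).1], S.le_nu_add (h₁ _ hx).2 ?_⟩
      exact S.le_nu_mul (by rw [S.nu_pi]; exact zero_le_one) (hR _ hy).2
    · intro z hz z' hz' h
      obtain ⟨⟨x, y⟩, hxy, rfl⟩ := Finset.mem_image.1 hz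
      obtain ⟨⟨x', y'⟩, hxy', rfl⟩ := Finset.mem_image.1 hz'
      obtain ⟨hx, hy⟩ := Finset.mem_product.1 hxy
      obtain ⟨hx', hy'⟩ := Finset.mem_product.1 hxy'
      obtain ⟨e₁, e₂⟩ := hinj x hx y hy x' hx' y' hy' h
      simp only [e₁, e₂]
    · intro z hz h0
      obtain ⟨x, ⟨hx, hxz⟩, -⟩ := hu z hz h0
      obtain ⟨u, hu1, hu2, hu3⟩ := S.exists_eq_pi_mul (by rw [map_sub, hz, (h₁ x hx).1]) hxz
      obtain ⟨y, hy, hyu⟩ := hRs u hu1 hu2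
      refine ⟨x + S.pi * y, Finset.mem_image.2 ⟨(x, y), Finset.mem_product.2 ⟨hx, hy⟩, rfl⟩, ?_⟩
      have e : z - (x + S.pi * y) = S.pi * (u - y) := by
        rw [← sub_sub, hu3]
        ring
      rw [e, S.nu_mul, S.nu_pi]
      exact_mod_cast (one_add_le_iff n _).2 hyu

/-- A trace-zero element is the multiple of `sqeps` by a fixed element of the same valuation. -/
lemma exists_eq_mul_sqeps {t : E} (ht : t + S.sig t = 0) :
    ∃ s, S.sig s = s ∧ S.nu s = S.nu t ∧ t = s * S.sqeps := by
  refine ⟨t / S.sqeps, ?_, S.nu_div_of_unit t S.nu_sqeps,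
    (div_mul_cancel₀ t S.sqeps_ne_zero).symm⟩
  rw [map_div₀, S.sig_sqeps, eq_neg_of_add_eq_zero_right ht, neg_div_neg_eq]

/-- The inverse of an element of the unitary group. -/
def unitaryInv (g : Mat E) : Mat E := w0 E * (g.map ⇑S.sig)ᵀ * w0 E

lemma w0_mul_w0 : w0 E * w0 E = 1 := by
  ext i j
  fin_cases i <;> fin_cases j <;> simp [w0, Matrix.mul_apply]

lemma unitaryInv_mul {g : Mat E} (hg : g ∈ Gset S) : S.unitaryInv g * g = 1 := by
  have h : (g.map ⇑S.sig)ᵀ * w0 E * g = w0 E := hg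
  rw [unitaryInv, Matrix.mul_assoc, Matrix.mul_assoc, ← Matrix.mul_assoc _ (w0 E), h, w0_mul_w0]

lemma mul_unitaryInv {g : Mat E} (hg : g ∈ Gset S) : g * S.unitaryInv g = 1 :=
  mul_eq_one_comm.1 (S.unitaryInv_mul hg)

lemma unitaryInv_eq (g : Mat E) :
    S.unitaryInv g = !![S.sig (g 1 1), S.sig (g 0 1); S.sig (g 1 0), S.sig (g 0 0)] := by
  ext i j
  fin_cases i <;> fin_cases j <;> simp [unitaryInv, w0, Matrix.mul_apply, Matrix.vecMul, dotProduct]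

lemma mul_unitaryInv_one_zero (x k : Mat E) :
    (x * S.unitaryInv k) 1 0 = x 1 0 * S.sig (k 1 1) + x 1 1 * S.sig (k 1 0) := by
  simp [unitaryInv_eq, Matrix.mul_apply]

lemma mul_mem_Kset {g h : Mat E} (hg : g ∈ Kset S) (hh : h ∈ Kset S) : g * h ∈ Kset S := by
  obtain ⟨hg1, hg2, hg3⟩ := hg
  obtain ⟨hh1, hh2, hh3⟩ := hh
  refine ⟨?_, fun i j => ?_, by rw [Matrix.det_mul, S.nu_mul, hg3, hh3, add_zero]⟩
  · have h1 : (g.map ⇑S.sig)ᵀ * w0 E * g = w0 E := hg1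
    have h2 : (h.map ⇑S.sig)ᵀ * w0 E * h = w0 E := hh1
    change ((g * h).map ⇑S.sig)ᵀ * w0 E * (g * h) = w0 E
    rw [Matrix.map_mul, Matrix.transpose_mul]
    calc _ = (h.map ⇑S.sig)ᵀ * ((g.map ⇑S.sig)ᵀ * w0 E * g) * h := by
          simp only [Matrix.mul_assoc]
      _ = w0 E := by rw [h1, h2]
  · rw [Matrix.mul_apply, Fin.sum_univ_two]
    exact S.le_nu_add (S.le_nu_mul (hg2 _ _) (hh2 _ _)) (S.le_nu_mul (hg2 _ _) (hh2 _ _))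

lemma unitaryInv_mem_Kset {g : Mat E} (hg : g ∈ Kset S) : S.unitaryInv g ∈ Kset S := by
  obtain ⟨hg1, hg2, hg3⟩ := hg
  refine ⟨?_, fun i j => ?_, ?_⟩
  · have e : ((S.unitaryInv g).map ⇑S.sig)ᵀ = w0 E * g * w0 E := by
      ext i j
      fin_cases i <;> fin_cases j <;>
        simp [unitaryInv_eq, w0, Matrix.mul_apply, Matrix.vecMul, dotProduct, S.sig_invol]
    change ((S.unitaryInv g).map ⇑S.sig)ᵀ * w0 E * S.unitaryInv g = w0 E
    rw [e, Matrix.mul_assoc _ (w0 E) (w0 E), w0_mul_w0, Matrix.mul_one, Matrix.mul_assoc,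
      S.mul_unitaryInv hg1, Matrix.mul_one]
  · rw [unitaryInv_eq]
    fin_cases i <;> fin_cases j <;> simp [S.nu_sig, hg2]
  · have e : (S.unitaryInv g).det = S.sig g.det := by
      rw [unitaryInv_eq, Matrix.det_fin_two, Matrix.det_fin_two]
      simp
      ring
    rw [e, S.nu_sig, hg3]

/-- The bottom row of an element of `K` is isotropic. -/
lemma bottom_row_isotropic {g : Mat E} (hg : g ∈ Kset S) :
    g 1 0 * S.sig (g 1 1) + g 1 1 * S.sig (g 1 0) = 0 := by
  rw [← S.mul_unitaryInv_one_zero, S.mul_unitaryInv hg.1]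
  exact Matrix.one_apply_ne (by decide)

/-- The bottom row of an element of `K` is primitive. -/
lemma bottom_row_primitive {g : Mat E} (hg : g ∈ Kset S) (hd : 1 ≤ S.nu (g 1 1)) :
    S.nu (g 1 0) = 0 := by
  by_contra hc
  have h := S.le_nu_sub (S.le_nu_mul (hg.2.1 0 0) hd)
    (S.le_nu_mul (hg.2.1 0 1) (S.one_le_nu (hg.2.1 1 0) hc))
  rw [← Matrix.det_fin_two, hg.2.2] at h
  exact not_one_le_zero h

/-- Ratios of the entries of an isotropic vector have trace zero. -/
lemma div_add_sig_div {x y : E} (h : x * S.sig y + y * S.sig x = 0) (hy : y ≠ 0) :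
    x / y + S.sig (x / y) = 0 := by
  have hy' : S.sig y ≠ 0 := (map_ne_zero S.sig).2 hy
  rw [map_div₀, div_add_div _ _ hy hy', h, zero_div]

/-- The lower unipotent matrix with entry `s * sqeps`. -/
def lowerRep (s : E) : Mat E := !![1, 0; s * S.sqeps, 1]

/-- An element of `K` with bottom row `(1, s * sqeps)`. -/
def weylRep (s : E) : Mat E := !![0, 1; 1, s * S.sqeps]

lemma lowerRep_mem_Kset {s : E} (hs : S.sig s = s) (h : 0 ≤ S.nu s) :
    S.lowerRep s ∈ Kset S := by
  refine ⟨?_, fun i j => ?_, ?_⟩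
  · change ((S.lowerRep s).map ⇑S.sig)ᵀ * w0 E * S.lowerRep s = w0 E
    ext i j
    fin_cases i <;> fin_cases j <;>
      simp [lowerRep, w0, Matrix.mul_apply, hs, S.sig_sqeps]
  · fin_cases i <;> fin_cases j <;>
      simp [lowerRep, S.nu_one, S.nu_zero, S.nu_mul, S.nu_sqeps, h]
  · simp [lowerRep, Matrix.det_fin_two, S.nu_one]

lemma weylRep_mem_Kset {s : E} (hs : S.sig s = s) (h : 0 ≤ S.nu s) :
    S.weylRep s ∈ Kset S := by
  refine ⟨?_, fun i j => ?_, ?_⟩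
  · change ((S.weylRep s).map ⇑S.sig)ᵀ * w0 E * S.weylRep s = w0 E
    ext i j
    fin_cases i <;> fin_cases j <;>
      simp [weylRep, w0, Matrix.mul_apply, hs, S.sig_sqeps]
  · fin_cases i <;> fin_cases j <;>
      simp [weylRep, S.nu_one, S.nu_zero, S.nu_mul, S.nu_sqeps, h]
  · simp [weylRep, Matrix.det_fin_two, S.nu_one, S.nu_neg]

/-- For `n ≥ 1` the group `𝓑 K_n` consists of the elements of `K` that are upper triangular
modulo `p_E ^ n`. -/
lemma mem_Bcal_mul_Kfil_iff {n : ℕ} (hn : 1 ≤ n) (x : Mat E) :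
    (∃ b ∈ Bcal S, ∃ g ∈ Kfil S (n : ℤ), x = b * g) ↔
      x ∈ Kset S ∧ ((n : ℤ) : WithTop ℤ) ≤ S.nu (x 1 0) := by
  constructor
  · rintro ⟨b, ⟨hb, hb0⟩, g, ⟨hg, hgn⟩, rfl⟩
    refine ⟨S.mul_mem_Kset hb hg, ?_⟩
    rw [Matrix.mul_apply, Fin.sum_univ_two, hb0, zero_mul, zero_add]
    have := hgn 1 0
    rw [Matrix.sub_apply, Matrix.one_apply_ne (by decide), sub_zero] at this
    exact S.le_nu_mul (hb.2.1 1 1) this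
  · rintro ⟨hx, hc⟩
    have hn1 : (1 : WithTop ℤ) ≤ ((n : ℤ) : WithTop ℤ) := by exact_mod_cast hn
    have hd : S.nu (x 1 1) = 0 := by
      by_contra hd
      have h := hn1.trans hc
      rw [S.bottom_row_primitive hx (S.one_le_nu (hx.2.1 1 1) hd)] at h
      exact not_one_le_zero h
    have hd0 := S.ne_zero_of_nu_eq_zero hd
    obtain ⟨s, hs, hsn, hst⟩ :=
      S.exists_eq_mul_sqeps (S.div_add_sig_div (S.bottom_row_isotropic hx) hd0)
    rw [S.nu_div_of_unit _ hd] at hsn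
    have hs0 : 0 ≤ S.nu s := hsn ▸ hx.2.1 1 0
    refine ⟨x * S.lowerRep (-s), ⟨S.mul_mem_Kset hx
      (S.lowerRep_mem_Kset (by rw [map_neg, hs]) (by rwa [S.nu_neg])), ?_⟩,
      S.lowerRep s, ⟨S.lowerRep_mem_Kset hs hs0, fun i j => ?_⟩, ?_⟩
    · have : x 1 0 = x 1 1 * (s * S.sqeps) := by rw [← hst, mul_div_cancel₀ _ hd0]
      simp [lowerRep, Matrix.mul_apply, this]
    · fin_cases i <;> fin_cases j <;>
        simp [lowerRep, S.nu_zero, S.nu_mul, S.nu_sqeps]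
      rw [hsn]
      exact_mod_cast hc
    · have : S.lowerRep (-s) * S.lowerRep s = 1 := by
        ext i j
        fin_cases i <;> fin_cases j <;> simp [lowerRep, Matrix.mul_apply]
      rw [Matrix.mul_assoc, this, Matrix.mul_one]

/-- The coset `𝓑 K_n k` described through the Hermitian pairing of bottom rows. -/
def rowCoset (n : ℕ) (k : Mat E) : Set (Mat E) :=
  {x | x ∈ Kset S ∧
    ((n : ℤ) : WithTop ℤ) ≤ S.nu (x 1 0 * S.sig (k 1 1) + x 1 1 * S.sig (k 1 0))}

lemma coset_eq_rowCoset {n : ℕ} (hn : 1 ≤ n) {k : Mat E} (hk : k ∈ Kset S) :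
    (fun x => x * k) '' {x | ∃ b ∈ Bcal S, ∃ g ∈ Kfil S (n : ℤ), x = b * g} =
      S.rowCoset n k := by
  ext x
  simp only [Set.mem_image, Set.mem_ofPred_eq, S.mem_Bcal_mul_Kfil_iff hn, rowCoset]
  constructor
  · rintro ⟨h, ⟨hK, hc⟩, rfl⟩
    refine ⟨S.mul_mem_Kset hK hk, ?_⟩
    rwa [← S.mul_unitaryInv_one_zero, Matrix.mul_assoc, S.mul_unitaryInv hk.1, Matrix.mul_one]
  · rintro ⟨hK, hc⟩
    refine ⟨x * S.unitaryInv k, ⟨S.mul_mem_Kset hK (S.unitaryInv_mem_Kset hk), ?_⟩, ?_⟩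
    · rwa [S.mul_unitaryInv_one_zero]
    · rw [Matrix.mul_assoc, S.unitaryInv_mul hk.1, Matrix.mul_one]

lemma self_mem_rowCoset (n : ℕ) {k : Mat E} (hk : k ∈ Kset S) : k ∈ S.rowCoset n k := by
  refine ⟨hk, ?_⟩
  rw [S.bottom_row_isotropic hk, S.nu_zero]
  exact le_top

/-- A coset is determined by any of its elements. -/
lemma rowCoset_eq_of_mem {n : ℕ} {k l : Mat E} (hk : k ∈ Kset S)
    (hl : l ∈ S.rowCoset n k) : S.rowCoset n l = S.rowCoset n k := by
  have hsub : ∀ {k l : Mat E}, k ∈ Kset S → l ∈ S.rowCoset n k →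
      S.rowCoset n l ⊆ S.rowCoset n k := by
    rintro k l hk ⟨hl, hlk⟩ x ⟨hx, hxl⟩
    refine ⟨hx, ?_⟩
    have e : x * S.unitaryInv k = (x * S.unitaryInv l) * (l * S.unitaryInv k) := by
      rw [Matrix.mul_assoc, ← Matrix.mul_assoc _ l, S.unitaryInv_mul hl.1, Matrix.one_mul]
    rw [← S.mul_unitaryInv_one_zero] at hlk hxl ⊢
    rw [e, Matrix.mul_apply, Fin.sum_univ_two]
    refine S.le_nu_add ?_ (S.le_nu_mul ?_ hlk)
    · rw [mul_comm]
      exact S.le_nu_mul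
        ((S.mul_mem_Kset hl (S.unitaryInv_mem_Kset hk)).2.1 0 0) hxl
    · exact (S.mul_mem_Kset hx (S.unitaryInv_mem_Kset hl)).2.1 1 1
  refine (hsub hk hl).antisymm (hsub hl.1 ⟨hk, ?_⟩)
  have := hl.2
  rw [← S.nu_sig, map_add, map_mul, map_mul, S.sig_invol, S.sig_invol] at this
  convert this using 2
  ring

end USetting

/-- for `n ≥ 1`, the subgroup `𝓑·K_n` has index `(q+1)·q^{n−1}` in `K`
(counted as the number of right cosets `(𝓑K_n)·k`, `k ∈ K`). -/
theorem stmt6 (S : USetting E) (n : ℕ) (hn : 1 ≤ n) :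
    Nat.card {s : Set (Mat E) // ∃ k ∈ Kset S,
        s = (fun x => x * k) '' {x | ∃ b ∈ Bcal S, ∃ g ∈ Kfil S (n : ℤ), x = b * g}}
      = (S.q + 1) * S.q ^ (n - 1) := by
  obtain ⟨m, rfl⟩ : ∃ m, n = m + 1 := ⟨n - 1, by omega⟩
  obtain ⟨R, hRc, hR, hRi, hRs⟩ := S.exists_representatives (m + 1)
  obtain ⟨P, hPc, hP, hPi, hPs⟩ := S.exists_representatives m
  have hpi : ∀ s ∈ P, S.sig (S.pi * s) = S.pi * s ∧ 1 ≤ S.nu (S.pi * s) := fun s hs => by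
    refine ⟨by rw [map_mul, S.sig_pi, (hP s hs).1], ?_⟩
    rw [mul_comm]
    exact S.le_nu_mul (hP s hs).2 S.nu_pi.ge
  have hlow : ∀ s ∈ R, S.lowerRep s ∈ Kset S := fun s hs =>
    S.lowerRep_mem_Kset (hR s hs).1 (hR s hs).2
  have hweyl : ∀ s ∈ P, S.weylRep (S.pi * s) ∈ Kset S := fun s hs =>
    S.weylRep_mem_Kset (hpi s hs).1 (zero_le_one.trans (hpi s hs).2)
  have hdisj : ∀ s ∈ R, ∀ t ∈ P,
      S.rowCoset (m + 1) (S.lowerRep s) ≠ S.rowCoset (m + 1) (S.weylRep (S.pi * t)) := by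
    intro s hs t ht h
    have hmem := (h ▸ S.self_mem_rowCoset (m + 1) (hlow s hs)).2
    have h1 : (1 : WithTop ℤ) ≤ (((m + 1 : ℕ) : ℤ) : WithTop ℤ) := by exact_mod_cast hn
    have h2 : 1 ≤ S.nu (s * S.sqeps * (S.sig (S.pi * t) * S.sqeps)) := by
      refine S.le_nu_mul ?_ ?_
      · rw [S.nu_mul, S.nu_sqeps, add_zero]
        exact (hR s hs).2
      · rw [S.nu_mul, S.nu_sqeps, add_zero, S.nu_sig]
        exact (hpi t ht).2
    have h3 := S.le_nu_add (h1.trans hmem) h2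
    simp [USetting.lowerRep, USetting.weylRep, S.sig_sqeps, S.nu_one] at h3
    exact USetting.not_one_le_zero h3
  have hmk : ∀ k ∈ Kset S, ∃ k' ∈ Kset S, S.rowCoset (m + 1) k =
      (fun x => x * k') '' {x | ∃ b ∈ Bcal S, ∃ g ∈ Kfil S ((m + 1 : ℕ) : ℤ), x = b * g} :=
    fun k hk => ⟨k, hk, (S.coset_eq_rowCoset hn hk).symm⟩
  let f : R ⊕ P → {s : Set (Mat E) // ∃ k ∈ Kset S,
        s = (fun x => x * k) '' {x | ∃ b ∈ Bcal S, ∃ g ∈ Kfil S ((m + 1 : ℕ) : ℤ), x = b * g}} :=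
    Sum.elim (fun s => ⟨S.rowCoset (m + 1) (S.lowerRep s), hmk _ (hlow s s.2)⟩)
      (fun s => ⟨S.rowCoset (m + 1) (S.weylRep (S.pi * s)), hmk _ (hweyl s s.2)⟩)
  have hf : Function.Bijective f := by
    constructor
    · rintro (⟨s, hs⟩ | ⟨s, hs⟩) (⟨t, ht⟩ | ⟨t, ht⟩) h <;>
        have h' := congrArg Subtype.val h <;> simp only [f, Sum.elim_inl, Sum.elim_inr] at h'
      · have hmem := (h' ▸ S.self_mem_rowCoset (m + 1) (hlow s hs)).2
        have e : S.lowerRep s 1 0 * S.sig (S.lowerRep t 1 1) +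
            S.lowerRep s 1 1 * S.sig (S.lowerRep t 1 0) = (s - t) * S.sqeps := by
          simp [USetting.lowerRep, S.sig_sqeps, (hR t ht).1]
          ring
        rw [e, S.nu_mul, S.nu_sqeps, add_zero] at hmem
        obtain rfl := hRi s hs t ht hmem
        rfl
      · exact absurd h' (hdisj s hs t ht)
      · exact absurd h'.symm (hdisj t ht s hs)
      · have hmem := (h' ▸ S.self_mem_rowCoset (m + 1) (hweyl s hs)).2
        have e : S.weylRep (S.pi * s) 1 0 * S.sig (S.weylRep (S.pi * t) 1 1) +
            S.weylRep (S.pi * s) 1 1 * S.sig (S.weylRep (S.pi * t) 1 0) =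
              S.pi * (s - t) * S.sqeps := by
          simp [USetting.weylRep, S.sig_sqeps, S.sig_pi, (hP t ht).1]
          ring
        rw [e, S.nu_mul, S.nu_sqeps, add_zero, S.nu_mul, S.nu_pi] at hmem
        obtain rfl := hPi s hs t ht ((USetting.one_add_le_iff m _).1 (by exact_mod_cast hmem))
        rfl
    · rintro ⟨_, k, hk, rfl⟩
      by_cases hd : S.nu (k 1 1) = 0
      · have hd0 := S.ne_zero_of_nu_eq_zero hd
        obtain ⟨s, hs, hsn, hst⟩ :=
          S.exists_eq_mul_sqeps (S.div_add_sig_div (S.bottom_row_isotropic hk) hd0)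
        rw [S.nu_div_of_unit _ hd] at hsn
        obtain ⟨t, ht, hts⟩ := hRs s hs (hsn ▸ hk.2.1 1 0)
        refine ⟨Sum.inl ⟨t, ht⟩, Subtype.ext ?_⟩
        refine Eq.trans (S.rowCoset_eq_of_mem (hlow t ht) ⟨hk, ?_⟩).symm (S.coset_eq_rowCoset hn hk).symm
        have hc : k 1 0 = k 1 1 * (s * S.sqeps) := by rw [← hst, mul_div_cancel₀ _ hd0]
        have e : k 1 0 * S.sig (S.lowerRep t 1 1) + k 1 1 * S.sig (S.lowerRep t 1 0) =
            k 1 1 * ((s - t) * S.sqeps) := by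
          simp [USetting.lowerRep, S.sig_sqeps, (hR t ht).1, hc]
          ring
        rwa [e, S.nu_mul, S.nu_mul, S.nu_sqeps, add_zero, hd, zero_add]
      · have hd1 := S.one_le_nu (hk.2.1 1 1) hd
        have hc := S.bottom_row_primitive hk hd1
        have hc0 := S.ne_zero_of_nu_eq_zero hc
        obtain ⟨s, hs, hsn, hst⟩ := S.exists_eq_mul_sqeps
          (S.div_add_sig_div ((add_comm _ _).trans (S.bottom_row_isotropic hk)) hc0)
        rw [S.nu_div_of_unit _ hc] at hsn
        obtain ⟨u, hu, hu0, rfl⟩ := S.exists_eq_pi_mul hs (hsn ▸ hd1)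
        obtain ⟨t, ht, htu⟩ := hPs u hu hu0
        refine ⟨Sum.inr ⟨t, ht⟩, Subtype.ext ?_⟩
        refine Eq.trans (S.rowCoset_eq_of_mem (hweyl t ht) ⟨hk, ?_⟩).symm (S.coset_eq_rowCoset hn hk).symm
        have hdc : k 1 1 = k 1 0 * (S.pi * u * S.sqeps) := by
          rw [← hst, mul_div_cancel₀ _ hc0]
        have e : k 1 0 * S.sig (S.weylRep (S.pi * t) 1 1) +
            k 1 1 * S.sig (S.weylRep (S.pi * t) 1 0) =
              k 1 0 * (S.pi * (u - t) * S.sqeps) := by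
          simp [USetting.weylRep, S.sig_sqeps, S.sig_pi, (hP t ht).1, hdc]
          ring
        rw [e, S.nu_mul, S.nu_mul, S.nu_mul, S.nu_sqeps, add_zero, hc, zero_add, S.nu_pi]
        exact_mod_cast (USetting.one_add_le_iff m _).2 htu
  rw [← Nat.card_eq_of_bijective f hf, Nat.card_sum, Nat.card_eq_fintype_card,
    Nat.card_eq_fintype_card, Fintype.card_coe, Fintype.card_coe, hRc, hPc, Nat.add_sub_cancel]
  ring
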